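/- Let 2 ≤ k̄ ≤ L/2, let Q = Σ_{A∈P_Λ, Diag A ≤ k̄} q_A A satisfy [H,Q] = 0, and let A be a Pauli product with Diag A = k̄. Then q_A = 0 unless both of the following hold: (1) A has a unique top-right site ū with either (1a) A_ū = X_ū and ū − e_x ∈ Supp A, or (1b) A_ū = Y_ū and ū − e_y ∈ Supp A; and (2) A has a unique bottom-left site u̲ with either (2a) A_u̲ = X_u̲ and u̲ + e_x ∈ Supp A, or (2b) A_u̲ = Y_u̲ and u̲ + e_y ∈ Supp A. -/

import Mathlib

open Complex Matrix

/-- Sites of the `L × L` square lattice with periodic boundary conditions. -/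
abbrev Site (L : ℕ) := ZMod L × ZMod L

/-- A specification of a product of Pauli matrices: at each site either
`0` (no operator), `1` (`X`), `2` (`Y`) or `3` (`Z`). -/
abbrev PSpec (L : ℕ) := Site L → Fin 4

/-- Operators on the Hilbert space `⊗_{u ∈ Λ} ℂ²`. -/
abbrev Op (L : ℕ) := Matrix (Site L → Fin 2) (Site L → Fin 2) ℂ

/-- The Pauli matrices (`0` gives the identity). -/
noncomputable def pauli (w : Fin 4) : Matrix (Fin 2) (Fin 2) ℂ :=
  if w = 1 then !![0, 1; 1, 0]
  else if w = 2 then !![0, -Complex.I; Complex.I, 0]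
  else if w = 3 then !![1, 0; 0, -1]
  else 1

/-- The product of Pauli matrices specified by `σ`, as an operator (matrix)
on the full Hilbert space. -/
noncomputable def PauliOp (L : ℕ) [NeZero L] (σ : PSpec L) : Op L :=
  fun s t => ∏ u : Site L, pauli (σ u) (s u) (t u)

/-- `DiagBoundAt L σ a k` : every site `u` in the support of `σ` satisfies
`0 ≤ uₓ + u_y − a ≤ k − 1 (mod L)`. -/
def DiagBoundAt (L : ℕ) (σ : PSpec L) (a : ZMod L) (k : ℕ) : Prop :=
  ∀ u : Site L, σ u ≠ 0 → (u.1 + u.2 - a).val < k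

/-- The diagonal length of a Pauli product. -/
noncomputable def Diag (L : ℕ) (σ : PSpec L) : ℕ :=
  sInf {k | ∃ a : ZMod L, DiagBoundAt L σ a k}

/-- `X_u` as a Pauli-product specification. -/
def sigX (L : ℕ) (u : Site L) : PSpec L := fun v => if v = u then 1 else 0
/-- `Y_u` as a Pauli-product specification. -/
def sigY (L : ℕ) (u : Site L) : PSpec L := fun v => if v = u then 2 else 0
/-- `Z_u` as a Pauli-product specification. -/
def sigZ (L : ℕ) (u : Site L) : PSpec L := fun v => if v = u then 3 else 0
/-- A single-site Pauli operator `W_u` (`w ∈ {1,2,3}`). -/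
def sigW (L : ℕ) (u : Site L) (w : Fin 4) : PSpec L := fun v => if v = u then w else 0

/-- `X_u X_{u+eₓ}` as a Pauli-product specification. -/
def sigXX (L : ℕ) (u : Site L) : PSpec L :=
  fun v => if v = u then 1 else if v = u + (1, 0) then 1 else 0
/-- `Y_u Y_{u+e_y}` as a Pauli-product specification. -/
def sigYY (L : ℕ) (u : Site L) : PSpec L :=
  fun v => if v = u then 2 else if v = u + (0, 1) then 2 else 0

/-- The quantum compass Hamiltonian
`H = −Σ_u (Jx X_u X_{u+eₓ} + Jy Y_u Y_{u+e_y})`. -/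
noncomputable def Hcompass (L : ℕ) [NeZero L] (Jx Jy : ℝ) : Op L :=
  - ∑ u : Site L, ((Jx : ℂ) • PauliOp L (sigXX L u) + (Jy : ℂ) • PauliOp L (sigYY L u))

/-- The quantum compass Hamiltonian with a uniform magnetic field. -/
noncomputable def Hfield (L : ℕ) [NeZero L] (Jx Jy hx hy hz : ℝ) : Op L :=
  - ∑ u : Site L,
      ((Jx : ℂ) • PauliOp L (sigXX L u) + (Jy : ℂ) • PauliOp L (sigYY L u)
        + (hx : ℂ) • PauliOp L (sigX L u) + (hy : ℂ) • PauliOp L (sigY L u)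
        + (hz : ℂ) • PauliOp L (sigZ L u))

/-- The candidate conserved quantity `Q = Σ_σ q_σ σ`. -/
noncomputable def Qop (L : ℕ) [NeZero L] (q : PSpec L → ℂ) : Op L :=
  ∑ σ : PSpec L, q σ • PauliOp L σ

/-- Commutator of operators. -/
noncomputable def opComm (L : ℕ) [NeZero L] (A B : Op L) : Op L := A * B - B * A

/-- The coefficient `λ_{σ,τ}` of the Pauli product `τ` in the expansion
`[H, σ] = Σ_τ λ_{σ,τ} τ`, extracted via the (normalized) trace inner product. -/
noncomputable def lam (L : ℕ) [NeZero L] (H : Op L) (σ τ : PSpec L) : ℂ :=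
  Matrix.trace (PauliOp L τ * opComm L H (PauliOp L σ)) / (2 ^ Fintype.card (Site L))

/-- `u` is a top-right site of `σ` (relative to the witness `a` for diagonal
length `k`). -/
def IsTopRight (L : ℕ) (σ : PSpec L) (a : ZMod L) (k : ℕ) (u : Site L) : Prop :=
  σ u ≠ 0 ∧ (u.1 + u.2 - a).val = k - 1

/-- `u` is a bottom-left site of `σ` (relative to the witness `a`). -/
def IsBottomLeft (L : ℕ) (σ : PSpec L) (a : ZMod L) (u : Site L) : Prop :=
  σ u ≠ 0 ∧ (u.1 + u.2 - a).val = 0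

/-- Condition (1): `σ` has a unique top-right site `ū`, with
(1a) `σ_ū = X` and `ū − eₓ ∈ Supp σ`, or (1b) `σ_ū = Y` and `ū − e_y ∈ Supp σ`. -/
def Cond1 (L : ℕ) (σ : PSpec L) (a : ZMod L) (k : ℕ) : Prop :=
  ∃ ub : Site L, (∀ v : Site L, IsTopRight L σ a k v ↔ v = ub) ∧
    ((σ ub = 1 ∧ σ (ub - (1, 0)) ≠ 0) ∨ (σ ub = 2 ∧ σ (ub - (0, 1)) ≠ 0))

/-- Condition (2): `σ` has a unique bottom-left site `u̲`, with
(2a) `σ_u̲ = X` and `u̲ + eₓ ∈ Supp σ`, or (2b) `σ_u̲ = Y` and `u̲ + e_y ∈ Supp σ`. -/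
def Cond2 (L : ℕ) (σ : PSpec L) (a : ZMod L) : Prop :=
  ∃ lb : Site L, (∀ v : Site L, IsBottomLeft L σ a v ↔ v = lb) ∧
    ((σ lb = 1 ∧ σ (lb + (1, 0)) ≠ 0) ∨ (σ lb = 2 ∧ σ (lb + (0, 1)) ≠ 0))

/-- `ShiftRel L k σ σ'` : `σ` has diagonal length `k`, satisfies conditions (1)
and (2), and `σ'` is the Shiraishi shift `S(σ)`, obtained by first appending a
site at the top right (the product `B`) and then truncating the bottom-left site. -/
def ShiftRel (L : ℕ) [NeZero L] (k : ℕ) (σ σ' : PSpec L) : Prop :=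
  Diag L σ = k ∧ σ' ≠ 0 ∧
  ∃ a : ZMod L, DiagBoundAt L σ a k ∧
  ∃ ub lb : Site L,
    (∀ v : Site L, IsTopRight L σ a k v ↔ v = ub) ∧
    (∀ v : Site L, IsBottomLeft L σ a v ↔ v = lb) ∧
    ∃ B : Op L,
      ((σ ub = 1 ∧ σ (ub - (1, 0)) ≠ 0 ∧
          B = (-(1 / (2 * Complex.I))) • opComm L (PauliOp L (sigYY L ub)) (PauliOp L σ)) ∨
       (σ ub = 2 ∧ σ (ub - (0, 1)) ≠ 0 ∧
          B = (1 / (2 * Complex.I)) • opComm L (PauliOp L (sigXX L ub)) (PauliOp L σ))) ∧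
      ∃ ε : ℂ, (ε = 1 / (2 * Complex.I) ∨ ε = -(1 / (2 * Complex.I))) ∧
        ((σ lb = 1 ∧ σ (lb + (1, 0)) ≠ 0 ∧
            PauliOp L σ' = ε • opComm L (PauliOp L (sigXX L lb)) B) ∨
         (σ lb = 2 ∧ σ (lb + (0, 1)) ≠ 0 ∧
            PauliOp L σ' = ε • opComm L (PauliOp L (sigYY L lb)) B))

/-- The staircase sequence `u_j`: `u_j = u₁ + ((j−1)/2)(eₓ+e_y)` for odd `j`,
and `u_j = u₁ + (j/2)(eₓ+e_y) − e_y` for even `j`. -/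
def stair (L : ℕ) (u1 : Site L) (j : ℕ) : Site L :=
  if j % 2 = 1 then
    u1 + ((((j - 1) / 2 : ℕ) : ZMod L), (((j - 1) / 2 : ℕ) : ZMod L))
  else
    u1 + (((j / 2 : ℕ) : ZMod L), ((j / 2 : ℕ) : ZMod L)) - ((0 : ZMod L), (1 : ZMod L))

/-- The Pauli letter at the first (bottom-left) end of `C^k_j`. -/
def endL (j : ℕ) : Fin 4 := if j % 2 = 1 then 1 else 2

/-- The Pauli letter at the last (top-right) end of `C^k_j`. -/
def endR (k j : ℕ) : Fin 4 :=
  if k % 2 = 1 then (if j % 2 = 1 then 2 else 1)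
  else (if j % 2 = 1 then 1 else 2)

/-- The standard-form product `C^k_j` based at `u₁`: the appropriate end
letters at `u_j` and `u_{j+k−1}`, and `Z` at `u_{j+1}, …, u_{j+k−2}`. -/
def Cspec (L : ℕ) (k j : ℕ) (u1 : Site L) : PSpec L := fun v =>
  if v = stair L u1 j then endL j
  else if v = stair L u1 (j + k - 1) then endR k j
  else if v ∈ (Finset.Icc (j + 1) (j + k - 2)).image (stair L u1) then 3
  else 0

/-- The scalar in the product rule `pauli a * pauli b = pauliPhase a b • pauli (a ^^^ b)`. -/
noncomputable def pauliPhase (a b : Fin 4) : ℂ :=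
  if a = 0 ∨ b = 0 ∨ a = b then 1
  else if (a = 1 ∧ b = 2) ∨ (a = 2 ∧ b = 3) ∨ (a = 3 ∧ b = 1) then Complex.I else -Complex.I

/-- The sign by which two Pauli matrices commute or anticommute. -/
noncomputable def pauliSign (a b : Fin 4) : ℂ :=
  if a = 0 ∨ b = 0 ∨ a = b then 1 else -1

lemma pauli_mul (a b : Fin 4) : pauli a * pauli b = pauliPhase a b • pauli (a ^^^ b) := by
  fin_cases a <;> fin_cases b <;> ext i j <;> fin_cases i <;> fin_cases j <;>
    simp [pauli, pauliPhase, Matrix.mul_apply, Fin.sum_univ_two]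

lemma pauliPhase_ne_zero (a b : Fin 4) : pauliPhase a b ≠ 0 := by
  unfold pauliPhase
  split_ifs <;> simp

lemma pauliPhase_swap (a b : Fin 4) : pauliPhase b a = pauliSign a b * pauliPhase a b := by
  fin_cases a <;> fin_cases b <;> simp [pauliPhase, pauliSign]

lemma sum_pauli_diag_eq_zero_iff (a : Fin 4) : ∑ i, pauli a i i = 0 ↔ a ≠ 0 := by
  fin_cases a <;> simp [pauli, Fin.sum_univ_two]

/-- The sitewise product of two Pauli specifications, up to phase. -/
def pauliXor (L : ℕ) (σ τ : PSpec L) : PSpec L := fun u => σ u ^^^ τ u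

lemma PauliOp_mul (L : ℕ) [NeZero L] (σ τ : PSpec L) :
    PauliOp L σ * PauliOp L τ =
      (∏ u, pauliPhase (σ u) (τ u)) • PauliOp L (pauliXor L σ τ) := by
  ext s t
  simp only [Matrix.mul_apply, PauliOp, Matrix.smul_apply, smul_eq_mul, pauliXor,
    ← Finset.prod_mul_distrib]
  rw [← Fintype.prod_sum (fun u i => pauli (σ u) (s u) i * pauli (τ u) i (t u))]
  refine Finset.prod_congr rfl fun u _ => ?_
  simpa [Matrix.mul_apply] using congrFun (congrFun (pauli_mul (σ u) (τ u)) (s u)) (t u)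

lemma PauliOp_mul_swap (L : ℕ) [NeZero L] (σ τ : PSpec L) :
    PauliOp L τ * PauliOp L σ =
      (∏ u, pauliSign (σ u) (τ u)) • (PauliOp L σ * PauliOp L τ) := by
  have h : pauliXor L τ σ = pauliXor L σ τ := by
    funext u
    exact (by decide : ∀ a b : Fin 4, a ^^^ b = b ^^^ a) _ _
  rw [PauliOp_mul, PauliOp_mul, h, smul_smul, ← Finset.prod_mul_distrib]
  simp only [← pauliPhase_swap]

lemma trace_PauliOp_eq_zero_iff (L : ℕ) [NeZero L] (σ : PSpec L) :
    Matrix.trace (PauliOp L σ) = 0 ↔ σ ≠ 0 := by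
  have h : Matrix.trace (PauliOp L σ) = ∏ u, ∑ i, pauli (σ u) i i := by
    rw [Fintype.prod_sum (fun u i => pauli (σ u) i i)]
    rfl
  rw [h, Finset.prod_eq_zero_iff, Function.ne_iff]
  simp [-Fin.sum_univ_two, sum_pauli_diag_eq_zero_iff]

lemma pauliXor_eq_zero_iff (L : ℕ) (σ τ : PSpec L) : pauliXor L σ τ = 0 ↔ τ = σ := by
  simp only [funext_iff]
  exact forall_congr' fun u =>
    (by decide : ∀ a b : Fin 4, a ^^^ b = 0 ↔ b = a) _ _

lemma trace_PauliOp_mul_mul_ne_zero_iff (L : ℕ) [NeZero L] (τ β σ : PSpec L) :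
    Matrix.trace (PauliOp L τ * (PauliOp L β * PauliOp L σ)) ≠ 0 ↔ σ = pauliXor L τ β := by
  rw [← mul_assoc, PauliOp_mul, Matrix.smul_mul, PauliOp_mul, Matrix.trace_smul,
    Matrix.trace_smul, smul_eq_mul, smul_eq_mul, ← pauliXor_eq_zero_iff]
  have h (σ τ : PSpec L) : ∏ u, pauliPhase (σ u) (τ u) ≠ 0 :=
    Finset.prod_ne_zero_iff.2 fun u _ => pauliPhase_ne_zero _ _
  simp [h, trace_PauliOp_eq_zero_iff]

/-- The Pauli letter on bonds of a given type. -/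
def bondLetter (c : Bool) : Fin 4 := if c then 1 else 2

/-- The displacement along bonds of a given type. -/
def bondDir (L : ℕ) (c : Bool) : Site L := if c then (1, 0) else (0, 1)

/-- The bond operator specification with displacement `E c` based at `u`. -/
def bond (L : ℕ) (E : Bool → Site L) (c : Bool) (u : Site L) : PSpec L :=
  fun v => if v = u then bondLetter c else if v = u + E c then bondLetter c else 0

/-- The Pauli letters `c` and `x` anticommute (for `c ≠ 0`). -/
def LetterAnti (c x : Fin 4) : Prop := x ≠ 0 ∧ x ≠ c

/-- The bond at `u` anticommutes with `σ`. -/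
def BondAnti (L : ℕ) (E : Bool → Site L) (σ : PSpec L) (c : Bool) (u : Site L) : Prop :=
  ¬ (LetterAnti (bondLetter c) (σ u) ↔ LetterAnti (bondLetter c) (σ (u + E c)))

lemma pauliSign_mul_ne_one_iff (c : Bool) (x y : Fin 4) :
    pauliSign (bondLetter c) x * pauliSign (bondLetter c) y ≠ 1 ↔
      ¬ (LetterAnti (bondLetter c) x ↔ LetterAnti (bondLetter c) y) := by
  cases c <;> fin_cases x <;> fin_cases y <;>
    simp [pauliSign, bondLetter, LetterAnti] <;> norm_num

lemma prod_pauliSign_bond_ne_one_iff (L : ℕ) [NeZero L] (E : Bool → Site L)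
    (σ : PSpec L) (c : Bool) (u : Site L) (hE : E c ≠ 0) :
    ∏ v, pauliSign (bond L E c u v) (σ v) ≠ 1 ↔ BondAnti L E σ c u := by
  have hne : u ≠ u + E c := by simpa using hE
  rw [Fintype.prod_eq_mul u (u + E c) hne, BondAnti, ← pauliSign_mul_ne_one_iff]
  · simp [bond]
  · rintro v ⟨h1, h2⟩
    simp [bond, h1, h2, pauliSign]

/-- A set of specifications is bond-closed when every product generated by an anticommuting bond
is also generated from some member through another bond. -/
def BondClosed (L : ℕ) (E : Bool → Site L) (S : PSpec L → Prop) : Prop :=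
  ∀ σ c u, S σ → BondAnti L E σ c u → ∃ c' u', (c', u') ≠ (c, u) ∧
    S (pauliXor L (pauliXor L σ (bond L E c u)) (bond L E c' u')) ∧
    BondAnti L E (pauliXor L (pauliXor L σ (bond L E c u)) (bond L E c' u')) c' u'

lemma bondClosed_of_opComm_eq_zero (L : ℕ) [NeZero L] (hL : 1 < L) (Jx Jy : ℝ)
    (hJx : Jx ≠ 0) (hJy : Jy ≠ 0) (q : PSpec L → ℂ)
    (hcons : opComm L (Hcompass L Jx Jy) (Qop L q) = 0) :
    BondClosed L (bondDir L) (fun σ => q σ ≠ 0) := by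
  have : Fact (1 < L) := ⟨hL⟩
  have hE : ∀ c, bondDir L c ≠ 0 := by
    intro c
    cases c <;> simp [bondDir, Prod.ext_iff]
  intro σ c u hσ hanti
  set τ := pauliXor L σ (bond L (bondDir L) c u) with hτ
  let J : Bool → ℂ := fun c => if c then Jx else Jy
  have hJ : ∀ c, J c ≠ 0 := by
    intro c
    cases c <;> simp [J, hJx, hJy]
  let f : PSpec L → PSpec L → ℂ := fun β ρ =>
    q ρ * ((1 - ∏ v, pauliSign (β v) (ρ v)) *
      Matrix.trace (PauliOp L τ * (PauliOp L β * PauliOp L ρ)))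
  let G : Bool × Site L → ℂ := fun b => J b.1 * ∑ ρ, f (bond L (bondDir L) b.1 b.2) ρ
  have hcomm : ∀ β, ∑ ρ, f β ρ =
      Matrix.trace (PauliOp L τ * opComm L (PauliOp L β) (Qop L q)) := by
    intro β
    simp only [opComm, Qop, Finset.mul_sum, Finset.sum_mul, ← Finset.sum_sub_distrib,
      Matrix.trace_sum]
    refine Finset.sum_congr rfl fun ρ _ => ?_
    rw [Matrix.mul_smul, Matrix.smul_mul, PauliOp_mul_swap L β ρ]
    simp only [f, ← smul_sub, Matrix.mul_smul, Matrix.mul_sub, Matrix.trace_smul,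
      Matrix.trace_sub, smul_eq_mul]
    ring
  have hsum : ∑ b, G b = 0 := by
    have h1 : Hcompass L Jx Jy =
        -∑ b : Bool × Site L, J b.1 • PauliOp L (bond L (bondDir L) b.1 b.2) := by
      rw [Fintype.sum_prod_type, Fintype.sum_bool, ← Finset.sum_add_distrib]
      rfl
    have h2 : Matrix.trace (PauliOp L τ * opComm L (Hcompass L Jx Jy) (Qop L q)) = -∑ b, G b := by
      simp only [G, hcomm, h1, opComm, Matrix.neg_mul, Matrix.mul_neg, Finset.sum_mul,
        Finset.mul_sum (s := (Finset.univ : Finset (Bool × Site L))), Matrix.smul_mul,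
        Matrix.mul_smul, Matrix.trace_sub, Matrix.trace_neg,
        Matrix.trace_sum, Matrix.trace_smul, smul_eq_mul, mul_sub, Finset.sum_sub_distrib]
      ring
    rw [hcons] at h2
    simpa using h2.symm
  have hxor : pauliXor L τ (bond L (bondDir L) c u) = σ := by
    funext v
    exact (by decide : ∀ a b : Fin 4, a ^^^ b ^^^ b = a) _ _
  have hf : ∀ β ρ, f β ρ ≠ 0 ↔
      q ρ ≠ 0 ∧ ∏ v, pauliSign (β v) (ρ v) ≠ 1 ∧ ρ = pauliXor L τ β := by
    intro β ρ
    simp only [f, mul_ne_zero_iff, trace_PauliOp_mul_mul_ne_zero_iff, sub_ne_zero]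
    rw [ne_comm (a := (1 : ℂ))]
  have hG : G (c, u) ≠ 0 := by
    refine mul_ne_zero (hJ c) ?_
    rw [Fintype.sum_eq_single σ]
    · exact (hf _ _).2 ⟨hσ, (prod_pauliSign_bond_ne_one_iff L _ σ c u (hE c)).2 hanti, hxor.symm⟩
    · intro ρ hρ
      by_contra h
      exact hρ (((hf _ _).1 h).2.2.trans hxor)
  obtain ⟨⟨c', u'⟩, hne, hb⟩ : ∃ b, b ≠ (c, u) ∧ G b ≠ 0 := by
    by_contra! h
    exact hG ((Fintype.sum_eq_single (c, u) h).symm.trans hsum)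
  obtain ⟨ρ, -, hρ⟩ := Finset.exists_ne_zero_of_sum_ne_zero (right_ne_zero_of_mul hb)
  obtain ⟨h1, h2, rfl⟩ := (hf _ _).1 hρ
  exact ⟨c', u', hne, h1, (prod_pauliSign_bond_ne_one_iff L _ _ c' u' (hE c')).1 h2⟩

lemma bond_neg (L : ℕ) (E : Bool → Site L) (c : Bool) (u : Site L) :
    bond L (-E) c u = bond L E c (u - E c) := by
  funext v
  simp only [bond, Pi.neg_apply, ← sub_eq_add_neg, sub_add_cancel]
  split_ifs <;> rfl

lemma bondAnti_neg_iff (L : ℕ) (E : Bool → Site L) (σ : PSpec L) (c : Bool) (u : Site L) :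
    BondAnti L (-E) σ c u ↔ BondAnti L E σ c (u - E c) := by
  simp only [BondAnti, Pi.neg_apply, ← sub_eq_add_neg, sub_add_cancel]
  tauto

lemma BondClosed.neg {L : ℕ} {E : Bool → Site L} {S : PSpec L → Prop}
    (h : BondClosed L E S) : BondClosed L (-E) S := by
  intro σ c u hσ hanti
  obtain ⟨c', u', hne, h1, h2⟩ := h σ c (u - E c) hσ ((bondAnti_neg_iff L E σ c u).1 hanti)
  refine ⟨c', u' + E c', ?_, ?_, ?_⟩
  · rintro ⟨⟩
    simp at hne
  · simpa [bond_neg] using h1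
  · simpa [bond_neg, bondAnti_neg_iff] using h2

lemma ZMod.add_natCast_ne {L : ℕ} (a : ZMod L) {i j : ℕ} (hi : i < L) (hj : j < L)
    (hij : i ≠ j) : a + (i : ZMod L) ≠ a + (j : ZMod L) := by
  intro h
  have h := (ZMod.natCast_eq_natCast_iff' i j L).1 (add_left_cancel h)
  rw [Nat.mod_eq_of_lt hi, Nat.mod_eq_of_lt hj] at h
  exact hij h

/-- In a bond-closed set of specifications of limited extent along `D`, every member of extremal
extent has a single lowest site, joined to its support by the bond of the matching letter. -/
lemma BondClosed.exists_unique_lowest {L : ℕ} {E : Bool → Site L} {S : PSpec L → Prop}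
    (hcl : BondClosed L E S) (D : Site L → ZMod L) (hD : ∀ u c, D (u + E c) = D u + 1)
    {k : ℕ} (hk : 2 ≤ k) (hkL : k + 2 ≤ L)
    (hS : ∀ σ, S σ → ∀ v w, σ v ≠ 0 → σ w ≠ 0 → D v ≠ D w + k)
    {σ : PSpec L} (hσ : S σ) (a : ZMod L)
    (hbd : ∀ u, σ u ≠ 0 → ∃ j : ℕ, j < k ∧ D u = a + j)
    {u : Site L} (hu : σ u ≠ 0) (hDu : D u = a + (k - 1 : ℕ))
    {w₀ : Site L} (hw₀ : σ w₀ ≠ 0) (hDw₀ : D w₀ = a) :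
    ∃ w, (∀ v, (σ v ≠ 0 ∧ D v = a) ↔ v = w) ∧ ∃ c, σ w = bondLetter c ∧ σ (w + E c) ≠ 0 := by
  have hsep : ∀ (b : ZMod L) {i j : ℕ} (x y : Site L), i < L → j < L → i ≠ j →
      D x = b + i → D y = b + j → x ≠ y := by
    rintro b i j x y hi hj hij hx hy rfl
    exact ZMod.add_natCast_ne b hi hj hij (hx.symm.trans hy)
  obtain ⟨c, hc⟩ : ∃ c, bondLetter c ≠ σ u := by
    by_cases h : σ u = 1
    · exact ⟨false, by simp [bondLetter, h]⟩
    · exact ⟨true, by simpa [bondLetter, eq_comm] using h⟩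
  have hl : ∀ c, bondLetter c ≠ 0 := by decide
  set v := u + E c with hv
  have hDv : D v = a + k := by
    rw [hv, hD, hDu, Nat.cast_sub (by omega)]
    push_cast
    ring
  have hσ0 : ∀ x (j : ℕ), k ≤ j → j < L → D x = a + j → σ x = 0 := by
    intro x j hkj hjL hx
    by_contra h
    obtain ⟨i, hi, hxi⟩ := hbd x h
    exact hsep a x x (by omega) hjL (by omega) hxi hx rfl
  have hσv : σ v = 0 := hσ0 v k le_rfl (by omega) hDv
  have huv : u ≠ v := hsep a u v (by omega) (by omega) (by omega) hDu hDv
  obtain ⟨c', u', hne, hS', hanti⟩ := hcl σ c u hσ (by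
    simp only [BondAnti, ← hv, hσv, LetterAnti]
    simp [hu, hc.symm])
  set τ := pauliXor L σ (bond L E c u) with hτ
  set σ' := pauliXor L τ (bond L E c' u') with hσ'
  have hτv : τ v = bondLetter c := by
    simp only [hτ, pauliXor, bond, hσv, huv.symm, if_false, ← hv, if_true]
    exact (by decide : ∀ a : Fin 4, 0 ^^^ a = a) _
  have hτo : ∀ x, x ≠ u → x ≠ v → τ x = σ x := by
    intro x h1 h2
    simp only [hτ, pauliXor, bond, h1, if_false, ← hv, h2]
    exact (by decide : ∀ a : Fin 4, a ^^^ 0 = a) _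
  set v' := u' + E c' with hv'
  have hDv' : D v' = D u' + 1 := hD u' c'
  have huv' : u' ≠ v' := by
    intro h
    refine hsep (D u') (i := 0) (j := 1) u' v' (by omega) (by omega) (by omega) (by simp) ?_ h
    simpa using hDv'
  have hσu' : σ' u' = τ u' ^^^ bondLetter c' := by simp [hσ', pauliXor, bond]
  have hσv' : σ' v' = τ v' ^^^ bondLetter c' := by
    simp [hσ', pauliXor, bond, ← hv']
  have hσo : ∀ x, x ≠ u' → x ≠ v' → σ' x = τ x := by
    intro x h1 h2
    simp only [hσ', pauliXor, bond, h1, if_false, ← hv', h2]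
    exact (by decide : ∀ a : Fin 4, a ^^^ 0 = a) _
  have hanti' : ¬ (LetterAnti (bondLetter c') (τ u' ^^^ bondLetter c') ↔
      LetterAnti (bondLetter c') (τ v' ^^^ bondLetter c')) := by
    rw [← hσu', ← hσv']
    exact hanti
  have hxor : ∀ a b : Fin 4, a ^^^ b = 0 → a = b := by decide
  have hinj : ∀ c c', bondLetter c = bondLetter c' → c = c' := by decide
  have key : ∀ x y : Fin 4, x = 0 ∨ x = bondLetter c' → y = 0 ∨ y = bondLetter c' →
      (LetterAnti (bondLetter c') (x ^^^ bondLetter c') ↔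
        LetterAnti (bondLetter c') (y ^^^ bondLetter c')) := by
    rintro x y (rfl | rfl) (rfl | rfl) <;> cases c' <;> simp [LetterAnti, bondLetter]
  have hσ'v : σ' v ≠ 0 := by
    intro h0
    by_cases h1 : v = u'
    · have hc' : c = c' := hinj _ _ (by rw [← hτv]; exact hxor _ _ (by rw [← h0, h1, hσu']))
      have hD' : D v' = a + (k + 1 : ℕ) := by
        rw [hDv', ← h1, hDv]
        push_cast
        ring
      have hτv' : τ v' = 0 := by
        rw [hτo v' (hsep a _ _ (by omega) (by omega) (by omega) hD' hDu)
          (hsep a _ _ (by omega) (by omega) (by omega) hD' hDv)]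
        exact hσ0 v' (k + 1) (by omega) (by omega) hD'
      exact hanti' (key _ _ (Or.inr (by rw [← h1, hτv, hc'])) (Or.inl hτv'))
    · by_cases h2 : v = v'
      · have hc' : c = c' := hinj _ _ (by rw [← hτv]; exact hxor _ _ (by rw [← h0, h2, hσv']))
        subst hc'
        exact hne (by rw [add_right_cancel (h2.symm : u' + E c = u + E c)])
      · exact hl c (by rw [← hτv, ← hσo v h1 h2, h0])
  have hlow : ∀ w, σ w ≠ 0 → D w = a → w = u' ∧ σ w = bondLetter c' := by
    intro w hw hDw
    have hDw0 : D w = a + (0 : ℕ) := by simpa using hDw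
    have hτw : τ w = σ w :=
      hτo w (hsep a _ _ (by omega) (by omega) (by omega) hDw0 hDu)
        (hsep a _ _ (by omega) (by omega) (by omega) hDw0 hDv)
    have hσ'w : σ' w = 0 := by
      by_contra h
      exact hS σ' hS' v w hσ'v h (by rw [hDw, hDv])
    by_cases h1 : w = u'
    · exact ⟨h1, by rw [← hτw]; exact hxor _ _ (by rw [← hσ'w, h1, hσu'])⟩
    · by_cases h2 : w = v'
      · exfalso
        have hDu' : D u' + 1 = a := by rw [← hDv', ← h2, hDw]
        have hτu' : τ u' = 0 := by
          have e0 : D u' = D u' + (0 : ℕ) := by simp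
          have hu'u : D u = D u' + (k : ℕ) := by
            rw [hDu, ← hDu', Nat.cast_sub (by omega)]
            push_cast
            ring
          have hu'v : D v = D u' + (k + 1 : ℕ) := by
            rw [hDv, ← hDu']
            push_cast
            ring
          rw [hτo u' (hsep _ _ _ (by omega) (by omega) (by omega) e0 hu'u)
            (hsep _ _ _ (by omega) (by omega) (by omega) e0 hu'v)]
          by_contra h
          obtain ⟨i, hi, hxi⟩ := hbd u' h
          refine hsep (D u') (i := 0) (j := i + 1) u' u' (by omega) (by omega) (by omega) e0 ?_ rfl
          rw [hxi, ← hDu', hxi]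
          push_cast
          linear_combination hxi - hDu'
        have hτv' : τ v' = bondLetter c' := hxor _ _ (by rw [← hσv', ← h2, hσ'w])
        exact hanti' (key _ _ (Or.inl hτu') (Or.inr hτv'))
      · exact absurd (by rw [← hτw, ← hσo w h1 h2, hσ'w]) hw
  obtain ⟨rfl, hlet⟩ := hlow w₀ hw₀ hDw₀
  refine ⟨w₀, fun x => ⟨fun hx => (hlow x hx.1 hx.2).1, ?_⟩, c', hlet, ?_⟩
  · rintro rfl
    exact ⟨hw₀, hDw₀⟩
  · have hDw0 : D w₀ = a + (0 : ℕ) := by simpa using hDw₀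
    have hD1 : D v' = a + (1 : ℕ) := by rw [hDv', hDw₀, Nat.cast_one]
    have hτw : τ w₀ = bondLetter c' := by
      rw [hτo w₀ (hsep a _ _ (by omega) (by omega) (by omega) hDw0 hDu)
        (hsep a _ _ (by omega) (by omega) (by omega) hDw0 hDv), hlet]
    by_cases h : v' = u
    · rwa [← hv', h]
    · rw [← hv', ← hτo v' h (hsep a _ _ (by omega) (by omega) (by omega) hD1 hDv)]
      intro h0
      exact hanti' (key _ _ (Or.inr hτw) (Or.inl h0))

lemma exists_diagBoundAt (L : ℕ) [NeZero L] (σ : PSpec L) :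
    ∃ a, DiagBoundAt L σ a (Diag L σ) :=
  Nat.sInf_mem (s := {k | ∃ a : ZMod L, DiagBoundAt L σ a k})
    ⟨L, 0, fun _ _ => ZMod.val_lt _⟩

/-- **Lemma 2 of the paper.** Let `2 ≤ k̄ ≤ L/2` and let `Q` be a
local conserved quantity. For a Pauli product `σ` with `Diag σ = k̄`, one has
`q_σ = 0` unless `σ` satisfies conditions (1) (unique top-right site with
(1a)/(1b)) and (2) (unique bottom-left site with (2a)/(2b)). -/
theorem coefficient_vanishes_unless_corner_conditions
    (L : ℕ) [NeZero L] (Jx Jy : ℝ) (hJx : Jx ≠ 0) (hJy : Jy ≠ 0)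
    (k : ℕ) (hk : 2 ≤ k) (hkL : 2 * k ≤ L)
    (q : PSpec L → ℂ)
    (hsupp : ∀ σ : PSpec L, q σ ≠ 0 → σ ≠ 0 ∧ Diag L σ ≤ k)
    (hcons : opComm L (Hcompass L Jx Jy) (Qop L q) = 0)
    (σ : PSpec L) (hdiag : Diag L σ = k) (hq : q σ ≠ 0) :
    ∃ a : ZMod L, DiagBoundAt L σ a k ∧ Cond1 L σ a k ∧ Cond2 L σ a := by
  have hcl := bondClosed_of_opComm_eq_zero L (by omega) Jx Jy hJx hJy q hcons
  obtain ⟨a, ha⟩ := exists_diagBoundAt L σ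
  rw [hdiag] at ha
  have hpos : ∀ x : ZMod L, x = a + ((x - a).val : ℕ) := by
    intro x
    rw [ZMod.natCast_zmod_val]
    ring
  have hval : ∀ (x : ZMod L) (j : ℕ), j < L → ((x - a).val = j ↔ x = a + j) := by
    intro x j hj
    constructor
    · rintro rfl
      exact hpos x
    · rintro rfl
      rw [add_sub_cancel_left, ZMod.val_natCast_of_lt hj]
  have hmin : ∀ b, ¬ DiagBoundAt L σ b (k - 1) := by
    intro b hb
    have : Diag L σ ≤ k - 1 := Nat.sInf_le ⟨b, hb⟩
    omega
  obtain ⟨t, ht, hDt⟩ : ∃ t, σ t ≠ 0 ∧ t.1 + t.2 = a + (k - 1 : ℕ) := by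
    by_contra! h
    refine hmin a fun u hu => ?_
    have h1 := ha u hu
    have h2 : (u.1 + u.2 - a).val ≠ k - 1 := fun e =>
      h u hu ((hval _ _ (by omega)).1 e)
    omega
  obtain ⟨b, hb, hDb⟩ : ∃ b, σ b ≠ 0 ∧ b.1 + b.2 = a := by
    by_contra! h
    refine hmin (a + 1) fun u hu => ?_
    have h1 := ha u hu
    have h2 : (u.1 + u.2 - a).val ≠ 0 := fun e =>
      h u hu (by simpa using (hval _ _ (by omega)).1 e)
    have h3 : u.1 + u.2 - (a + 1) = (((u.1 + u.2 - a).val - 1 : ℕ) : ZMod L) := by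
      rw [Nat.cast_sub (by omega), ZMod.natCast_zmod_val]
      push_cast
      ring
    rw [h3, ZMod.val_natCast_of_lt (by omega)]
    omega
  have hS : ∀ ρ, q ρ ≠ 0 → ∀ v w : Site L, ρ v ≠ 0 → ρ w ≠ 0 →
      v.1 + v.2 ≠ w.1 + w.2 + k := by
    intro ρ hρ v w hv hw h
    obtain ⟨b, hb⟩ := exists_diagBoundAt L ρ
    have hd := (hsupp ρ hρ).2
    have h1 := hb v hv
    have h2 := hb w hw
    have h3 : v.1 + v.2 - b = (((w.1 + w.2 - b).val + k : ℕ) : ZMod L) := by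
      push_cast
      rw [ZMod.natCast_zmod_val, h]
      ring
    rw [h3, ZMod.val_natCast_of_lt (by omega)] at h1
    omega
  have hbd : ∀ u, σ u ≠ 0 → ∃ j : ℕ, j < k ∧ u.1 + u.2 = a + j := fun u hu =>
    ⟨_, ha u hu, hpos _⟩
  refine ⟨a, ha, ?_, ?_⟩
  · obtain ⟨w, hw, c, hc⟩ := hcl.neg.exists_unique_lowest (fun u => -(u.1 + u.2))
      (by
        rintro u (_ | _) <;> simp [bondDir] <;> ring)
      hk (by omega)
      (fun ρ hρ v w hv hw h => hS ρ hρ w v hw hv (by linear_combination h))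
      hq (-(a + (k - 1 : ℕ)))
      (fun u hu => by
        obtain ⟨j, hj, h⟩ := hbd u hu
        refine ⟨k - 1 - j, by omega, ?_⟩
        rw [h, Nat.cast_sub (by omega : j ≤ k - 1)]
        ring)
      hb (by rw [hDb]; ring) ht (by rw [hDt])
    refine ⟨w, fun v => ?_, ?_⟩
    · rw [← hw v, IsTopRight, hval _ _ (by omega), neg_inj]
    · cases c
      · exact Or.inr (by simpa [bondLetter, bondDir, sub_eq_add_neg] using hc)
      · exact Or.inl (by simpa [bondLetter, bondDir, sub_eq_add_neg] using hc)
  · obtain ⟨w, hw, c, hc⟩ := hcl.exists_unique_lowest (fun u => u.1 + u.2)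
      (by
        rintro u (_ | _) <;> simp [bondDir] <;> ring)
      hk (by omega) hS hq a hbd ht hDt hb hDb
    refine ⟨w, fun v => ?_, ?_⟩
    · rw [← hw v, IsBottomLeft, hval _ _ (by omega), Nat.cast_zero, add_zero]
    · cases c
      · exact Or.inr (by simpa [bondLetter, bondDir] using hc)
      · exact Or.inl (by simpa [bondLetter, bondDir] using hc)
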